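/- (Combinatorial form of the k-SUM theorem.) There is a universal constant C > 0 such that the following holds for all integers n ≥ 2 and 1 ≤ k ≤ n. Let H_k := {h ∈ {0,1}^n : Σᵢ hᵢ = k} ⊆ ℝ^n. Then for every x ∈ ℝ^n there exists a subset S ⊆ H_k with |S| ≤ C·k·n·(log₂ n)² such that H_k ⊆ infer(S,x). In particular, the answers to the label queries sign(Σ_{i∈I} x_i) for the k-subsets I indexing elements of S, together with the comparison queries sign(Σ_{i∈I} x_i − Σ_{j∈J} x_j) for pairs of k-subsets I, J indexing elements of S, determine whether some k distinct coordinates of x sum to 0. -/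

import Mathlib

open Finset

namespace LDT

/-- The standard inner product on `ℝ^n`. -/
def ip {n : ℕ} (x h : Fin n → ℝ) : ℝ := ∑ i, x i * h i

/-- `S` infers `h` at `x`: the sign of `⟨x,h⟩` is determined by the signs of `⟨x,v⟩` for
`v ∈ S ∪ (S - S)`, i.e. every `x'` with the same sign pattern as `x` on `S ∪ (S-S)` gives the
same sign on `h`. -/
def Infers {n : ℕ} (S : Finset (Fin n → ℝ)) (x h : Fin n → ℝ) : Prop :=
  ∀ x' : Fin n → ℝ,
    (∀ v ∈ S, SignType.sign (ip x' v) = SignType.sign (ip x v)) →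
    (∀ v ∈ S, ∀ w ∈ S, SignType.sign (ip x' (v - w)) = SignType.sign (ip x (v - w))) →
    SignType.sign (ip x' h) = SignType.sign (ip x h)

/-- `H` has inference dimension at most `d`: every subset `S ⊆ H` of size at least `d` contains,
for every `x`, an element `h` inferred by `S \ {h}` at `x`. -/
def InfProp {n : ℕ} (H : Finset (Fin n → ℝ)) (d : ℕ) : Prop :=
  ∀ S ⊆ H, d ≤ S.card → ∀ x : Fin n → ℝ, ∃ h ∈ S, Infers (S.erase h) x h

open scoped Classical

/-- The set `H_k = {h ∈ {0,1}^n : ∑ᵢ hᵢ = k}` of 0-1 vectors of Hamming weight `k`,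
as a subset of `ℝ^n`. -/
noncomputable def kSumH (n k : ℕ) : Finset (Fin n → ℝ) :=
  (Fintype.piFinset (fun _ : Fin n => ({0, 1} : Finset ℝ))).filter
    (fun h => ∑ i, h i = (k : ℝ))

theorem ip_zero_right {n : ℕ} (x : Fin n → ℝ) : ip x 0 = 0 := by
  simp [ip]

theorem ip_sub_right {n : ℕ} (x v w : Fin n → ℝ) : ip x (v - w) = ip x v - ip x w := by
  simp [ip, mul_sub, Finset.sum_sub_distrib]

theorem ip_neg_left {n : ℕ} (x v : Fin n → ℝ) : ip (-x) v = -ip x v := by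
  simp [ip]

theorem ip_sum_smul_right {n : ℕ} {ι : Type*} (x : Fin n → ℝ) (s : Finset ι) (c : ι → ℝ)
    (e : ι → Fin n → ℝ) : ip x (∑ i ∈ s, c i • e i) = ∑ i ∈ s, c i * ip x (e i) := by
  simp only [ip, Finset.sum_apply, Pi.smul_apply, smul_eq_mul, Finset.mul_sum]
  rw [Finset.sum_comm]
  exact Finset.sum_congr rfl fun i _ => Finset.sum_congr rfl fun j _ => by ring

theorem Infers.mono {n : ℕ} {S T : Finset (Fin n → ℝ)} {x h : Fin n → ℝ} (hST : S ⊆ T)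
    (hS : Infers S x h) : Infers T x h :=
  fun x' h₁ h₂ => hS x' (fun v hv => h₁ v (hST hv))
    fun v hv w hw => h₂ v (hST hv) w (hST hw)

theorem Infers.of_mem {n : ℕ} {S : Finset (Fin n → ℝ)} {x h : Fin n → ℝ} (hS : h ∈ S) :
    Infers S x h :=
  fun _ h₁ _ => h₁ h hS

theorem Infers.of_neg {n : ℕ} {S : Finset (Fin n → ℝ)} {x h : Fin n → ℝ}
    (hS : Infers S (-x) h) : Infers S x h := by
  intro x' h₁ h₂
  have := hS (-x') (fun v hv => by simp only [ip_neg_left, Left.sign_neg, h₁ v hv])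
    fun v hv w hw => by simp only [ip_neg_left, Left.sign_neg, h₂ v hv w hw]
  simpa only [ip_neg_left, Left.sign_neg, neg_inj] using this

theorem sign_sum_mul_eq {ι : Type*} (s : Finset ι) (c a b : ι → ℝ) (hc : ∀ i ∈ s, 0 ≤ c i)
    (ha : ∀ i ∈ s, 0 ≤ a i) (hab : ∀ i ∈ s, SignType.sign (b i) = SignType.sign (a i)) :
    SignType.sign (∑ i ∈ s, c i * b i) = SignType.sign (∑ i ∈ s, c i * a i) := by
  have hb : ∀ i ∈ s, 0 ≤ b i := fun i hi =>
    sign_nonneg_iff.1 (hab i hi ▸ sign_nonneg_iff.2 (ha i hi))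
  have hA : 0 ≤ ∑ i ∈ s, c i * a i := Finset.sum_nonneg fun i hi => mul_nonneg (hc i hi) (ha i hi)
  have hB : 0 ≤ ∑ i ∈ s, c i * b i := Finset.sum_nonneg fun i hi => mul_nonneg (hc i hi) (hb i hi)
  have hzero : ∑ i ∈ s, c i * b i = 0 ↔ ∑ i ∈ s, c i * a i = 0 := by
    rw [Finset.sum_eq_zero_iff_of_nonneg fun i hi => mul_nonneg (hc i hi) (hb i hi),
      Finset.sum_eq_zero_iff_of_nonneg fun i hi => mul_nonneg (hc i hi) (ha i hi)]
    refine forall₂_congr fun i hi => ?_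
    rw [mul_eq_zero, mul_eq_zero, ← sign_eq_zero_iff (a := a i), ← hab i hi, sign_eq_zero_iff]
  rcases hA.eq_or_lt with h | h
  · rw [← h, hzero.2 h.symm]
  · rw [sign_pos h, sign_pos (hB.lt_of_ne fun h' => h.ne' (hzero.1 h'.symm))]

/-- Pigeonhole on subset sums: among the increments of a long sequence of `0`-`1` vectors, some
increment is a combination of the earlier ones with coefficients of absolute value at most `1`. -/
theorem exists_increment_eq_sum {n m : ℕ} (z : ℕ → Fin n → ℤ)
    (hz : ∀ i ≤ m, ∀ j, 0 ≤ z i j ∧ z i j ≤ 1) (hm : (2 * m + 1) ^ n < 2 ^ m) :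
    ∃ p < m, ∃ β : ℕ → ℤ, (∀ i, |β i| ≤ 1) ∧
      z (p + 1) - z p = ∑ i ∈ range p, β i • (z (i + 1) - z i) := by
  obtain ⟨A, hA, B, hB, hne, hAB⟩ := Finset.exists_ne_map_eq_of_card_lt_of_maps_to
    (s := (range m).powerset)
    (t := Fintype.piFinset fun _ : Fin n => Finset.Icc (-(m : ℤ)) m)
    (f := fun A => ∑ i ∈ A, (z (i + 1) - z i))
    (by
      have hcard : (Finset.Icc (-(m : ℤ)) m).card = 2 * m + 1 := by
        rw [Int.card_Icc]; omega
      simpa [Fintype.card_piFinset, hcard] using hm)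
    (by
      intro A hA
      have hA' : A ⊆ range m := Finset.mem_powerset.1 (Finset.mem_coe.1 hA)
      have hle : (A.card : ℤ) ≤ m := by
        exact_mod_cast (Finset.card_le_card hA').trans_eq (Finset.card_range m)
      simp only [Finset.mem_coe, Fintype.mem_piFinset, Finset.mem_Icc, Finset.sum_apply,
        ← abs_le]
      intro j
      refine (Finset.abs_sum_le_sum_abs _ _).trans (le_trans ?_ hle)
      rw [Finset.card_eq_sum_ones, Nat.cast_sum]
      refine Finset.sum_le_sum fun i hi => ?_
      have hi' := Finset.mem_range.1 (hA' hi)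
      have h₁ := hz i hi'.le j
      have h₂ := hz (i + 1) hi' j
      simp only [Pi.sub_apply, Nat.cast_one, abs_le]
      omega)
  rw [Finset.mem_powerset] at hA hB
  let γ : ℕ → ℤ := fun i => (if i ∈ A then 1 else 0) - if i ∈ B then 1 else 0
  have hsum : ∑ i ∈ range m, γ i • (z (i + 1) - z i) = 0 := by
    simp only [γ, sub_smul, Finset.sum_sub_distrib, ite_smul, one_smul, zero_smul,
      Finset.sum_ite_mem, Finset.inter_eq_right.2 hA, Finset.inter_eq_right.2 hB]
    simpa [sub_eq_zero] using hAB
  have hex : ((range m).filter fun i => γ i ≠ 0).Nonempty := by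
    by_contra hcon
    rw [Finset.not_nonempty_iff_eq_empty, Finset.filter_eq_empty_iff] at hcon
    refine hne (Finset.ext fun i => ?_)
    by_cases hi : i ∈ range m
    · have := hcon hi
      simp only [γ] at this
      split_ifs at this <;> simp_all
    · exact iff_of_false (fun h => hi (hA h)) fun h => hi (hB h)
  obtain ⟨p, hp, hmax⟩ := Finset.exists_max_image _ id hex
  simp only [Finset.mem_filter, Finset.mem_range, id] at hp hmax
  have hγ : ∀ i, γ i = -1 ∨ γ i = 0 ∨ γ i = 1 := by
    intro i
    simp only [γ]
    split_ifs <;> simp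
  refine ⟨p, hp.1, fun i => -(γ p * γ i), fun i => ?_, ?_⟩
  · rcases hγ p with h | h | h <;> rcases hγ i with h' | h' | h' <;> simp [h, h']
  · have hsub : ∑ i ∈ range (p + 1), γ i • (z (i + 1) - z i) = 0 := by
      rw [← hsum]
      refine Finset.sum_subset (Finset.range_subset_range.2 hp.1) fun i hi hi' => ?_
      have : γ i = 0 := by
        by_contra hcon
        exact hi' (Finset.mem_range.2
          (Nat.lt_succ_of_le (hmax i ⟨Finset.mem_range.1 hi, hcon⟩)))
      rw [this, zero_smul]
    rw [Finset.sum_range_succ] at hsub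
    simp only [neg_smul, Finset.sum_neg_distrib, mul_smul, ← Finset.smul_sum]
    rw [eq_neg_of_add_eq_zero_left hsub, smul_neg, neg_neg, smul_smul]
    rcases hγ p with h | h | h
    · simp [h]
    · exact absurd h hp.2
    · simp [h]

/-- In a long sequence of `0`-`1` vectors starting at `0` along which `⟨x, ·⟩` is monotone, some
vector is inferred at `x` by the earlier ones. -/
theorem exists_infers_of_monotone {n m : ℕ} (x : Fin n → ℝ) (G : ℕ → Fin n → ℝ) (hG0 : G 0 = 0)
    (hG : ∀ i < m, ∀ j, G (i + 1) j = 0 ∨ G (i + 1) j = 1)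
    (hmono : ∀ i < m, ip x (G i) ≤ ip x (G (i + 1))) (hm : (2 * m + 1) ^ n < 2 ^ m) :
    ∃ p < m, Infers ((range p).image fun i => G (i + 1)) x (G (p + 1)) := by
  have hG' : ∀ i ≤ m, ∀ j, G i j = 0 ∨ G i j = 1 := by
    rintro (_ | i) hi j
    · simp [hG0]
    · exact hG i hi j
  let z : ℕ → Fin n → ℤ := fun i j => if G i j = 1 then 1 else 0
  have hzG : ∀ i ≤ m, ∀ j, (z i j : ℝ) = G i j := by
    intro i hi j
    rcases hG' i hi j with h | h <;> simp [z, h]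
  obtain ⟨p, hp, β, hβ, hsum⟩ := exists_increment_eq_sum (m := m) z
    (fun i _ j => by simp only [z]; split_ifs <;> simp) hm
  have hGp : G (p + 1) = ∑ i ∈ range p, (1 + (β i : ℝ)) • (G (i + 1) - G i) := by
    have htel : G p = ∑ i ∈ range p, (G (i + 1) - G i) := by
      rw [Finset.sum_range_sub, hG0, sub_zero]
    have hinc : G (p + 1) - G p = ∑ i ∈ range p, (β i : ℝ) • (G (i + 1) - G i) := by
      ext j
      have := congrArg (fun v : Fin n → ℤ => ((v j : ℤ) : ℝ)) hsum
      simp only [Pi.sub_apply, Finset.sum_apply, Pi.smul_apply, smul_eq_mul, Int.cast_sub,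
        Int.cast_sum, Int.cast_mul, hzG p hp.le, hzG (p + 1) hp] at this ⊢
      rw [this]
      refine Finset.sum_congr rfl fun i hi => ?_
      have hi' := Finset.mem_range.1 hi
      rw [hzG i (by omega), hzG (i + 1) (by omega)]
    simp only [add_smul, one_smul, Finset.sum_add_distrib]
    rw [← htel, ← hinc, add_sub_cancel]
  refine ⟨p, hp, fun x' h₁ h₂ => ?_⟩
  have hmem : ∀ i < p, G (i + 1) ∈ (range p).image fun i => G (i + 1) := fun i hi =>
    Finset.mem_image_of_mem (fun i => G (i + 1)) (Finset.mem_range.2 hi)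
  rw [hGp, ip_sum_smul_right, ip_sum_smul_right]
  refine sign_sum_mul_eq _ _ _ _ (fun i _ => ?_) (fun i hi => ?_) fun i hi => ?_
  · have : -1 ≤ β i := (abs_le.1 (hβ i)).1
    have : (-1 : ℝ) ≤ β i := by exact_mod_cast this
    linarith
  · rw [ip_sub_right]
    exact sub_nonneg.2 (hmono i ((Finset.mem_range.1 hi).trans hp))
  · have hi' := Finset.mem_range.1 hi
    rcases i with _ | i
    · simpa [hG0] using h₁ _ (hmem 0 hi')
    · exact h₂ _ (hmem (i + 1) hi') _ (hmem i (by omega))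

/-- Greedy selection in increasing order of `⟨x, ·⟩`, keeping a vector exactly when the vectors
kept before do not infer it. -/
theorem exists_greedy_sequence {n : ℕ} (x : Fin n → ℝ) (P : Finset (Fin n → ℝ)) :
    (∀ h ∈ P, 0 ≤ ip x h) → ∃ (m : ℕ) (G : ℕ → Fin n → ℝ), G 0 = 0 ∧
      (∀ i < m, G (i + 1) ∈ P) ∧ (∀ i < m, ip x (G i) ≤ ip x (G (i + 1))) ∧
      (∀ i < m, ¬ Infers ((range i).image fun i => G (i + 1)) x (G (i + 1))) ∧
      ∀ h ∈ P, Infers ((range m).image fun i => G (i + 1)) x h := by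
  induction P using Finset.induction_on_max_value (fun h => ip x h) with
  | empty => exact fun _ => ⟨0, 0, by simp⟩
  | insert a s _ hmax ih =>
    intro hP
    obtain ⟨m, G, hG0, hGs, hmono, hnot, hinf⟩ :=
      ih fun h hh => hP h (Finset.mem_insert_of_mem hh)
    by_cases ha : Infers ((range m).image fun i => G (i + 1)) x a
    · refine ⟨m, G, hG0, fun i hi => Finset.mem_insert_of_mem (hGs i hi), hmono, hnot, ?_⟩
      intro h hh
      rcases Finset.mem_insert.1 hh with rfl | hh
      · exact ha
      · exact hinf h hh
    · let G' := Function.update G (m + 1) a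
      have hG'a : G' (m + 1) = a := Function.update_self ..
      have hG' : ∀ i ≤ m, G' i = G i := fun i hi => Function.update_of_ne (by omega) ..
      have himage : ∀ i ≤ m, ((range i).image fun i => G' (i + 1)) =
          (range i).image fun i => G (i + 1) := fun i hi =>
        Finset.image_congr fun j hj => hG' _ (by
          have := Finset.mem_range.1 (Finset.mem_coe.1 hj)
          omega)
      refine ⟨m + 1, G', (hG' 0 (by omega)).trans hG0, fun i hi => ?_, fun i hi => ?_,
        fun i hi => ?_, fun h hh => ?_⟩
      · rcases Nat.lt_succ_iff_lt_or_eq.1 hi with hi | rfl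
        · rw [hG' _ hi]
          exact Finset.mem_insert_of_mem (hGs i hi)
        · rw [hG'a]
          exact Finset.mem_insert_self ..
      · rcases Nat.lt_succ_iff_lt_or_eq.1 hi with hi | rfl
        · rw [hG' _ hi, hG' _ hi.le]
          exact hmono i hi
        · rw [hG'a, hG' _ le_rfl]
          rcases i with _ | i
          · rw [hG0, ip_zero_right]
            exact hP a (Finset.mem_insert_self ..)
          · exact hmax _ (hGs i (Nat.lt_succ_self i))
      · rcases Nat.lt_succ_iff_lt_or_eq.1 hi with hi | rfl
        · rw [hG' _ hi, himage i hi.le]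
          exact hnot i hi
        · rwa [hG'a, himage i le_rfl]
      · rcases Finset.mem_insert.1 hh with rfl | hh
        · exact Infers.of_mem (Finset.mem_image.2 ⟨m, Finset.self_mem_range_succ m, hG'a⟩)
        · refine (hinf h hh).mono ?_
          rw [← himage m le_rfl]
          exact Finset.image_subset_image (Finset.range_subset_range.2 (Nat.le_succ m))

theorem le_mul_logb_of_two_pow_le {n m : ℕ} (hn : 2 ≤ n) (hm : 2 ^ m ≤ (2 * m + 1) ^ n) :
    (m : ℝ) ≤ 10 * n * Real.logb 2 n := by
  have hn0 : (0 : ℝ) < n := by positivity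
  have hL : 1 ≤ Real.logb 2 n := by
    rw [Real.le_logb_iff_rpow_le (by norm_num) hn0, Real.rpow_one]
    exact_mod_cast hn
  rcases Nat.eq_zero_or_pos m with rfl | hm0
  · simp only [Nat.cast_zero]
    positivity
  have hm0' : (1 : ℝ) ≤ m := by exact_mod_cast hm0
  have hlog2 : (1 / 2 : ℝ) < Real.log 2 := by linarith [Real.log_two_gt_d9]
  set t : ℝ := m / n with ht
  have ht0 : 0 < t := by positivity
  have hmt : (m : ℝ) = t * n := by rw [ht]; field_simp
  have h₁ : (m : ℝ) * Real.log 2 ≤ n * Real.log (4 * t * n) := by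
    have h : (2 : ℝ) ^ m ≤ (4 * t * n) ^ n := by
      calc (2 : ℝ) ^ m ≤ (2 * m + 1) ^ n := by exact_mod_cast hm
        _ ≤ (4 * t * n) ^ n := by
          gcongr
          nlinarith
    have := Real.log_le_log (by positivity) h
    rwa [Real.log_pow, Real.log_pow] at this
  have h₂ : t * Real.log 2 ≤ Real.log (4 * t * n) := by
    rw [hmt] at h₁
    nlinarith
  have h₃ : Real.log (4 * t * n) = 4 * Real.log 2 + Real.log (t / 4) + Real.log n := by
    rw [show 4 * t * (n : ℝ) = 2 ^ 4 * (t / 4) * n by ring,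
      Real.log_mul (by positivity) (by positivity), Real.log_mul (by positivity) (by positivity),
      Real.log_pow]
    norm_num
  have h₄ : Real.log (t / 4) ≤ t / 4 - 1 := Real.log_le_sub_one_of_pos (by positivity)
  have h₅ : Real.log n = Real.logb 2 n * Real.log 2 := by
    rw [Real.logb, div_mul_cancel₀ _ (by positivity)]
  have h₆ : t ≤ 10 * Real.logb 2 n := by
    nlinarith
  rw [hmt]
  nlinarith

theorem exists_small_infers_of_nonneg {n : ℕ} (hn : 2 ≤ n) (x : Fin n → ℝ)
    (P : Finset (Fin n → ℝ)) (hP : ∀ h ∈ P, ∀ j, h j = 0 ∨ h j = 1)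
    (hx : ∀ h ∈ P, 0 ≤ ip x h) :
    ∃ S ⊆ P, (S.card : ℝ) ≤ 10 * n * Real.logb 2 n ∧ ∀ h ∈ P, Infers S x h := by
  obtain ⟨m, G, hG0, hGP, hmono, hnot, hinf⟩ := exists_greedy_sequence x P hx
  refine ⟨_, ?_, ?_, hinf⟩
  · intro v hv
    obtain ⟨i, hi, rfl⟩ := Finset.mem_image.1 hv
    exact hGP i (Finset.mem_range.1 hi)
  · have hcard : (((range m).image fun i => G (i + 1)).card : ℝ) ≤ m := by
      exact_mod_cast Finset.card_image_le.trans_eq (Finset.card_range m)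
    refine hcard.trans (le_mul_logb_of_two_pow_le hn ?_)
    by_contra! hm
    obtain ⟨p, hp, hp'⟩ := exists_infers_of_monotone x G hG0
      (fun i hi => hP _ (hGP i hi)) hmono hm
    exact hnot p hp hp'

theorem exists_small_infers {n : ℕ} (hn : 2 ≤ n) (x : Fin n → ℝ)
    (P : Finset (Fin n → ℝ)) (hP : ∀ h ∈ P, ∀ j, h j = 0 ∨ h j = 1) :
    ∃ S ⊆ P, (S.card : ℝ) ≤ 20 * n * Real.logb 2 n ∧ ∀ h ∈ P, Infers S x h := by
  obtain ⟨S, hSP, hS, hSinf⟩ := exists_small_infers_of_nonneg hn x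
    (P.filter fun h => 0 ≤ ip x h) (fun h hh => hP h (Finset.mem_of_mem_filter h hh))
    fun h hh => (Finset.mem_filter.1 hh).2
  obtain ⟨T, hTP, hT, hTinf⟩ := exists_small_infers_of_nonneg hn (-x)
    (P.filter fun h => 0 ≤ ip (-x) h) (fun h hh => hP h (Finset.mem_of_mem_filter h hh))
    fun h hh => (Finset.mem_filter.1 hh).2
  refine ⟨S ∪ T, Finset.union_subset (hSP.trans (Finset.filter_subset _ _))
    (hTP.trans (Finset.filter_subset _ _)), ?_, fun h hh => ?_⟩
  · have : ((S ∪ T).card : ℝ) ≤ S.card + T.card := by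
      exact_mod_cast Finset.card_union_le S T
    linarith
  · rcases le_total 0 (ip x h) with hx | hx
    · exact (hSinf h (Finset.mem_filter.2 ⟨hh, hx⟩)).mono Finset.subset_union_left
    · refine (Infers.of_neg (hTinf h (Finset.mem_filter.2 ⟨hh, ?_⟩))).mono
        Finset.subset_union_right
      rw [ip_neg_left]
      exact neg_nonneg.2 hx

/-- Theorem 1.1, combinatorial form: there is a universal constant `C > 0`
such that for `n ≥ 2`, `1 ≤ k ≤ n`, and every `x ∈ ℝ^n`, there is `S ⊆ H_k` with
`|S| ≤ C·k·n·(log₂ n)²` such that `S` infers every `h ∈ H_k` at `x`; in particular the label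
and comparison queries on `S` determine whether some `k` distinct coordinates of `x` sum
to `0`. -/
theorem kSUM_combinatorial :
    ∃ C : ℝ, 0 < C ∧ ∀ (n k : ℕ), 2 ≤ n → 1 ≤ k → k ≤ n →
      ∀ x : Fin n → ℝ,
        ∃ S ⊆ kSumH n k,
          ((S.card : ℝ) ≤ C * k * n * (Real.logb 2 n) ^ 2) ∧
          (∀ h ∈ kSumH n k, Infers S x h) ∧
          (∀ x' : Fin n → ℝ,
            (∀ v ∈ S, SignType.sign (ip x' v) = SignType.sign (ip x v)) →
            (∀ v ∈ S, ∀ w ∈ S,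
              SignType.sign (ip x' (v - w)) = SignType.sign (ip x (v - w))) →
            ((∃ h ∈ kSumH n k, ip x h = 0) ↔ (∃ h ∈ kSumH n k, ip x' h = 0))) := by
  refine ⟨20, by norm_num, fun n k hn hk _ x => ?_⟩
  obtain ⟨S, hSH, hS, hinf⟩ := exists_small_infers hn x (kSumH n k) fun h hh j => by
    simpa using Fintype.mem_piFinset.1 (Finset.mem_filter.1 hh).1 j
  refine ⟨S, hSH, hS.trans ?_, hinf, fun x' h₁ h₂ => exists_congr fun h =>
    and_congr_right fun hh => ?_⟩
  · have hL : 1 ≤ Real.logb 2 n := by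
      rw [Real.le_logb_iff_rpow_le (by norm_num) (by positivity), Real.rpow_one]
      exact_mod_cast hn
    have hk' : (1 : ℝ) ≤ k := by exact_mod_cast hk
    calc 20 * n * Real.logb 2 n = 20 * 1 * n * (Real.logb 2 n * 1) := by ring
      _ ≤ 20 * k * n * (Real.logb 2 n * Real.logb 2 n) := by gcongr
      _ = 20 * k * n * Real.logb 2 n ^ 2 := by ring
  · rw [← sign_eq_zero_iff, ← hinf h hh x' h₁ h₂, sign_eq_zero_iff]

end LDT
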